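/- A set S ⊆ κ is subtle if and only if for every S-list ⟨S_α : α ∈ S⟩ and every club C ⊆ κ there is an α ∈ S ∩ C such that there is a set H ⊆ S ∩ C ∩ α which is homogeneous for ⟨S_α : α ∈ S⟩ and is Π^1_n-indescribable in α for all n < ω. -/

import Mathlib

namespace LCI


/-- `κ` is (the initial ordinal of) a regular uncountable cardinal. -/
def RegUncountable (kappa : Ordinal.{0}) : Prop :=
  Ordinal.omega0 < kappa ∧ kappa.cof.ord = kappa

/-- `C` is a club (closed unbounded) subset of the ordinal `κ`. -/
def IsClubIn (C : Set Ordinal.{0}) (kappa : Ordinal.{0}) : Prop :=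
  C ⊆ Set.Iio kappa ∧
  (∀ alpha < kappa, ∃ beta ∈ C, alpha < beta) ∧
  ∀ beta < kappa, beta ≠ 0 →
    (∀ gamma < beta, ∃ delta ∈ C, gamma < delta ∧ delta < beta) → beta ∈ C

/-- `S` is a stationary subset of the ordinal `κ`. -/
def IsStationaryIn (S : Set Ordinal.{0}) (kappa : Ordinal.{0}) : Prop :=
  S ⊆ Set.Iio kappa ∧ ∀ C, IsClubIn C kappa → (S ∩ C).Nonempty

/-- `H` is homogeneous for the list `L` (where `L α ⊆ α` on the relevant domain):
whenever `α < β` are both in `H`, `L α = L β ∩ α`. -/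
def Homog (L : Ordinal.{0} → Set Ordinal.{0}) (H : Set Ordinal.{0}) : Prop :=
  ∀ alpha ∈ H, ∀ beta ∈ H, alpha < beta → L alpha = L beta ∩ Set.Iio alpha

/-- `S ⊆ κ` is a subtle subset of `κ`: for every `S`-list `L` (i.e. `L α ⊆ α` for
`α ∈ S`) and every club `C ⊆ κ` there are `α < β` in `S ∩ C` with `L α = L β ∩ α`. -/
def IsSubtleIn (S : Set Ordinal.{0}) (kappa : Ordinal.{0}) : Prop :=
  S ⊆ Set.Iio kappa ∧
  ∀ L : Ordinal.{0} → Set Ordinal.{0}, (∀ alpha ∈ S, L alpha ⊆ Set.Iio alpha) →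
    ∀ C, IsClubIn C kappa →
      ∃ alpha ∈ S ∩ C, ∃ beta ∈ S ∩ C, alpha < beta ∧ L alpha = L beta ∩ Set.Iio alpha

/-- Second-order formulas over a structure `(M, ∈, A)` where `M` is a set of sets:
de Bruijn indexed first-order variables and second-order (subset) variables,
a binary membership relation, and a unary predicate for `A`. -/
inductive SOForm : Type where
  | mem : ℕ → ℕ → SOForm
  | app : ℕ → ℕ → SOForm
  | inA : ℕ → SOForm
  | not : SOForm → SOForm
  | and : SOForm → SOForm → SOForm
  | fall : SOForm → SOForm
  | sall : SOForm → SOForm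

/-- Prepend a value to a valuation (de Bruijn style). -/
def consVal {alpha : Type 1} (x : alpha) (v : ℕ → alpha) : ℕ → alpha
  | 0 => x
  | n + 1 => v n

/-- Satisfaction of a second-order formula in the structure `(M, ∈, A)`,
relative to first- and second-order valuations; first-order quantifiers range
over `M` and second-order quantifiers range over subsets of `M`. -/
def SOSat (M A : Set ZFSet.{0}) : SOForm → (ℕ → ZFSet.{0}) → (ℕ → Set ZFSet.{0}) → Prop
  | .mem i j, v, _ => v i ∈ v j
  | .app i j, v, w => v j ∈ w i
  | .inA i, v, _ => v i ∈ A
  | .not phi, v, w => ¬ SOSat M A phi v w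
  | .and phi psi, v, w => SOSat M A phi v w ∧ SOSat M A psi v w
  | .fall phi, v, w => ∀ x ∈ M, SOSat M A phi (consVal x v) w
  | .sall phi, v, w => ∀ P : Set ZFSet.{0}, P ⊆ M → SOSat M A phi v (consVal P w)

/-- A formula is first-order if it contains no second-order quantifier. -/
def SOForm.FO : SOForm → Prop
  | .not phi => phi.FO
  | .and phi psi => phi.FO ∧ psi.FO
  | .fall phi => phi.FO
  | .sall _ => False
  | _ => True

mutual
  /-- `IsPiForm n φ` : `φ` is a `Π¹ₙ` formula. -/
  inductive IsPiForm : ℕ → SOForm → Prop where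
    | fo {phi : SOForm} : phi.FO → IsPiForm 0 phi
    | up {n : ℕ} {phi : SOForm} : IsSigmaForm n phi → IsPiForm (n + 1) phi
    | all {n : ℕ} {phi : SOForm} : IsPiForm (n + 1) phi → IsPiForm (n + 1) (SOForm.sall phi)
  /-- `IsSigmaForm n φ` : `φ` is a `Σ¹ₙ` formula. -/
  inductive IsSigmaForm : ℕ → SOForm → Prop where
    | fo {phi : SOForm} : phi.FO → IsSigmaForm 0 phi
    | up {n : ℕ} {phi : SOForm} : IsPiForm n phi → IsSigmaForm (n + 1) phi
    | ex {n : ℕ} {phi : SOForm} : IsSigmaForm (n + 1) phi →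
        IsSigmaForm (n + 1) (SOForm.not (SOForm.sall (SOForm.not phi)))
end

/-- Satisfaction of a sentence: satisfaction under the default valuations. -/
def SOSatS (M A : Set ZFSet.{0}) (phi : SOForm) : Prop :=
  SOSat M A phi (fun _ => ∅) (fun _ => ∅)

/-- The rank-initial segment `V_α` of the set-theoretic universe. -/
def Vrank (alpha : Ordinal.{0}) : Set ZFSet.{0} := {x | ZFSet.rank x < alpha}

/-- `X ⊆ κ` is a `Π¹ₙ`-indescribable subset of `κ` : for every `A ⊆ V_κ` and every
`Π¹ₙ` sentence `φ`, if `(V_κ, ∈, A) ⊨ φ` then `(V_ξ, ∈, A ∩ V_ξ) ⊨ φ` for some `ξ ∈ X`. -/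
def PiIndesc (n : ℕ) (X : Set Ordinal.{0}) (kappa : Ordinal.{0}) : Prop :=
  X ⊆ Set.Iio kappa ∧
  ∀ A : Set ZFSet.{0}, A ⊆ Vrank kappa → ∀ phi : SOForm, IsPiForm n phi →
    SOSatS (Vrank kappa) A phi → ∃ xi ∈ X, SOSatS (Vrank xi) (A ∩ Vrank xi) phi

section Coding

open Cardinal Ordinal

variable {c : Cardinal.{0}} {S : Set Ordinal.{0}}

theorem RegUncountable.exists_isRegular {kappa : Ordinal.{0}} (h : RegUncountable kappa) :
    ∃ c : Cardinal.{0}, c.IsRegular ∧ ℵ₀ < c ∧ kappa = c.ord := by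
  refine ⟨kappa.cof, ⟨?_, ?_⟩, ?_, h.2.symm⟩
  · rw [← ord_le_ord, h.2, ord_aleph0]; exact h.1.le
  · rw [h.2]
  · rw [← ord_lt_ord, h.2, ord_aleph0]; exact h.1

theorem isClubIn_Ioo {kappa mu : Ordinal.{0}} (hkappa : Order.IsSuccLimit kappa)
    (hmu : mu < kappa) : IsClubIn (Set.Ioo mu kappa) kappa := by
  refine ⟨fun x hx => hx.2, fun alpha ha => ?_, fun beta hb h0 h => ?_⟩
  · exact ⟨max mu alpha + 1, ⟨Order.lt_add_one_iff.2 (le_max_left _ _),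
      hkappa.add_one_lt (max_lt hmu ha)⟩, Order.lt_add_one_iff.2 (le_max_right _ _)⟩
  · obtain ⟨delta, hd, _, hdb⟩ := h 0 (pos_iff_ne_zero.2 h0)
    exact ⟨hd.1.trans hdb, hb⟩

theorem IsClubIn.pos_mem {C : Set Ordinal.{0}} {kappa : Ordinal.{0}} (hC : IsClubIn C kappa) :
    IsClubIn {alpha ∈ C | 0 < alpha} kappa := by
  refine ⟨fun x hx => hC.1 hx.1, fun alpha ha => ?_, fun beta hb h0 h => ⟨?_, ?_⟩⟩
  · obtain ⟨beta, hb, hlt⟩ := hC.2.1 alpha ha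
    exact ⟨beta, ⟨hb, bot_le.trans_lt hlt⟩, hlt⟩
  · refine hC.2.2 beta hb h0 fun gamma hg => ?_
    obtain ⟨delta, hd, h1, h2⟩ := h gamma hg
    exact ⟨delta, hd.1, h1, h2⟩
  · exact pos_iff_ne_zero.2 h0

/-- A regular uncountable cardinal carrying a subtle set is inaccessible. -/
theorem IsSubtleIn.isInaccessible (hc : c.IsRegular) (hc' : ℵ₀ < c)
    (h : IsSubtleIn S c.ord) : c.IsInaccessible := by
  refine ⟨hc', hc.2, fun mu hmu => ?_⟩
  by_contra! hle
  have hcard : #(Set.Iio c.ord) ≤ #(Set (Set.Iio mu.ord)) := by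
    rw [Cardinal.mk_Iio_ordinal, mk_set, Cardinal.mk_Iio_ordinal, card_ord, card_ord, ← lift_two_power, Cardinal.lift_le]
    exact hle
  obtain ⟨e⟩ := hcard
  classical
  let L : Ordinal.{0} → Set Ordinal.{0} := fun alpha =>
    if ha : alpha < c.ord ∧ mu.ord < alpha then Subtype.val '' e ⟨alpha, ha.1⟩ else ∅
  obtain ⟨alpha, ha, beta, hb, hab, heq⟩ := h.2 L (fun alpha _ x hx => by
      by_cases hca : alpha < c.ord ∧ mu.ord < alpha
      · simp only [L, hca, and_self, dite_true] at hx
        obtain ⟨y, _, rfl⟩ := hx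
        exact lt_trans y.2 hca.2
      · simp [L, hca] at hx)
    _ (isClubIn_Ioo (isSuccLimit_ord hc.aleph0_le) (ord_lt_ord.2 hmu))
  have ha' := ha.2
  have hb' := hb.2
  simp only [L, ha'.1, ha'.2, hb'.1, hb'.2, and_self, dite_true] at heq
  have hsub : (Subtype.val '' e ⟨beta, hb'.2⟩ : Set Ordinal.{0}) ∩ Set.Iio alpha =
      Subtype.val '' e ⟨beta, hb'.2⟩ := by
    refine Set.inter_eq_left.2 ?_
    rintro _ ⟨y, _, rfl⟩
    exact lt_trans y.2 ha'.1
  rw [hsub] at heq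
  have := e.injective (Subtype.val_injective.image_injective heq)
  exact hab.ne (congrArg Subtype.val this)

/-- The points of a club that bound the coding `f` of everything of rank below them
form a club. -/
theorem IsClubIn.closurePoints {X : Type 1} (hc : c.IsRegular) (hc' : ℵ₀ < c)
    (r : X → Ordinal.{0}) (hr : ∀ alpha < c.ord, #{x | r x ≤ alpha} < lift.{1} c)
    (f : X → Ordinal.{0}) (hf : ∀ x, r x < c.ord → f x < c.ord)
    {C : Set Ordinal.{0}} (hC : IsClubIn C c.ord) :
    IsClubIn {alpha ∈ C | ∀ x, r x < alpha → f x < alpha} c.ord := by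
  have hcof : ℵ₀ < c.ord.cof := by rwa [hc.cof_ord]
  have hsmall : ∀ alpha < c.ord, BddAbove (f '' {x | r x ≤ alpha}) ∧
      sSup (f '' {x | r x ≤ alpha}) < c.ord := by
    intro alpha ha
    refine ⟨⟨c.ord, ?_⟩, sSup_lt_of_lt_cof ?_ ?_⟩
    · rintro _ ⟨x, hx, rfl⟩
      exact (hf x (lt_of_le_of_lt hx ha)).le
    · rw [← lift_cof, hc.cof_ord]
      exact mk_image_le.trans_lt (hr alpha ha)
    · rintro _ ⟨x, hx, rfl⟩
      exact hf x (lt_of_le_of_lt hx ha)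
  have hstep : ∀ alpha, ∃ beta, alpha < c.ord →
      beta ∈ C ∧ alpha < beta ∧ ∀ x, r x ≤ alpha → f x < beta := by
    intro alpha
    by_cases ha : alpha < c.ord
    · obtain ⟨hbdd, hlt⟩ := hsmall alpha ha
      obtain ⟨beta, hb, hlt'⟩ := hC.2.1 _ (max_lt ha hlt)
      refine ⟨beta, fun _ => ⟨hb, (le_max_left _ _).trans_lt hlt', fun x hx => ?_⟩⟩
      exact ((le_csSup hbdd ⟨x, hx, rfl⟩).trans (le_max_right _ _)).trans_lt hlt'
    · exact ⟨0, fun h => absurd h ha⟩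
  choose g hg using hstep
  refine ⟨fun x hx => hC.1 hx.1, fun alpha ha => ?_, fun beta hb h0 h => ⟨?_, fun x hx => ?_⟩⟩
  · have hgc : ∀ beta < c.ord, g beta < c.ord := fun beta hb => hC.1 (hg beta hb).1
    have hit : ∀ n, g^[n] alpha < c.ord := fun n => by
      induction n with
      | zero => exact ha
      | succ n ih => rw [Function.iterate_succ_apply']; exact hgc _ ih
    have hsucc : ∀ n, g^[n + 1] alpha ∈ C ∧ g^[n] alpha < g^[n + 1] alpha ∧
        ∀ x, r x ≤ g^[n] alpha → f x < g^[n + 1] alpha := fun n => by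
      rw [Function.iterate_succ_apply']; exact hg _ (hit n)
    have hlt : ∀ n, g^[n] alpha < nfp g alpha := fun n =>
      (hsucc n).2.1.trans_le (iterate_le_nfp g alpha (n + 1))
    have hnfp : nfp g alpha < c.ord := nfp_lt_ord hcof hgc ha
    refine ⟨nfp g alpha, ⟨hC.2.2 _ hnfp ?_ fun gamma hgam => ?_, fun x hx => ?_⟩, hlt 0⟩
    · exact (bot_le.trans_lt (hlt 0)).ne'
    · obtain ⟨n, hn⟩ := lt_nfp_iff.1 hgam
      exact ⟨_, (hsucc n).1, hn.trans (hsucc n).2.1, hlt _⟩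
    · obtain ⟨n, hn⟩ := lt_nfp_iff.1 hx
      exact ((hsucc n).2.2 x hn.le).trans (hlt _)
  · refine hC.2.2 beta hb h0 fun gamma hgam => ?_
    obtain ⟨delta, hd, h1, h2⟩ := h gamma hgam
    exact ⟨delta, hd.1, h1, h2⟩
  · obtain ⟨delta, hd, h1, h2⟩ := h (r x) hx
    exact (hd.2 x h1).trans h2

/-- Subtlety for lists of subsets of an arbitrary ranked class with fewer than `κ` elements of
each rank below `κ`. -/
theorem IsSubtleIn.exists_coherent {X : Type 1} (hc : c.IsRegular) (hc' : ℵ₀ < c)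
    (h : IsSubtleIn S c.ord)
    (r : X → Ordinal.{0}) (hr : ∀ alpha < c.ord, #{x | r x ≤ alpha} < lift.{1} c)
    (T : Ordinal.{0} → Set X) {C : Set Ordinal.{0}} (hC : IsClubIn C c.ord) :
    ∃ alpha ∈ S ∩ C, ∃ beta ∈ S ∩ C, alpha < beta ∧
      ∀ x, r x < alpha → (x ∈ T alpha ↔ x ∈ T beta) := by
  have hcard : #{x | r x < c.ord} ≤ #(Set.Iio c.ord) := by
    have hsub : {x | r x < c.ord} ⊆ ⋃ alpha : Set.Iio c.ord, {x | r x ≤ alpha} :=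
      fun x hx => Set.mem_iUnion.2 ⟨⟨r x, hx⟩, le_refl (r x)⟩
    refine (mk_le_mk_of_subset hsub).trans ((mk_iUnion_le _).trans ?_)
    rw [Cardinal.mk_Iio_ordinal, card_ord]
    refine (mul_le_mul_right (ciSup_le' fun alpha => (hr _ alpha.2).le) _).trans ?_
    exact (mul_eq_self (aleph0_le_lift.2 hc.aleph0_le)).le
  obtain ⟨e⟩ := hcard
  classical
  let f : X → Ordinal.{0} := fun x => if hx : r x < c.ord then e ⟨x, hx⟩ else 0
  have hfe : ∀ x (hx : r x < c.ord), f x = e ⟨x, hx⟩ := fun x hx => dif_pos hx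
  have hf : ∀ x, r x < c.ord → f x < c.ord := fun x hx => by
    rw [hfe x hx]; exact (e ⟨x, hx⟩).2
  have hinj : ∀ x y, r x < c.ord → r y < c.ord → f x = f y → x = y := by
    intro x y hx hy hxy
    rw [hfe x hx, hfe y hy] at hxy
    exact congrArg Subtype.val (e.injective (Subtype.val_injective hxy))
  obtain ⟨alpha, ha, beta, hb, hab, heq⟩ := h.2
    (fun alpha => f '' {x ∈ T alpha | r x < alpha} ∩ Set.Iio alpha)
    (fun alpha _ => Set.inter_subset_right) _ (hC.closurePoints hc hc' r hr f hf)
  have hbc : beta < c.ord := h.1 hb.1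
  refine ⟨alpha, ⟨ha.1, ha.2.1⟩, beta, ⟨hb.1, hb.2.1⟩, hab, fun x hx => ?_⟩
  have key := Set.ext_iff.1 heq (f x)
  have hfx : f x < alpha := ha.2.2 x hx
  have hmem : ∀ gamma < c.ord, r x < gamma →
      (f x ∈ f '' {x ∈ T gamma | r x < gamma} ↔ x ∈ T gamma) := by
    intro gamma hgam hxg
    refine ⟨?_, fun hx' => ⟨x, ⟨hx', hxg⟩, rfl⟩⟩
    rintro ⟨y, ⟨hy, hyg⟩, hyx⟩
    rwa [← hinj y x (hyg.trans hgam) (hxg.trans hgam) hyx]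
  simpa [-Set.mem_image, hfx, hfx.trans hab, hmem alpha (hab.trans hbc) hx,
    hmem beta hbc (hx.trans hab)] using key

/-- An injective numbering of second-order formulas. -/
def SOForm.code : SOForm → ℕ
  | .mem i j => Nat.pair 0 (Nat.pair i j)
  | .app i j => Nat.pair 1 (Nat.pair i j)
  | .inA i => Nat.pair 2 i
  | .not phi => Nat.pair 3 phi.code
  | .and phi psi => Nat.pair 4 (Nat.pair phi.code psi.code)
  | .fall phi => Nat.pair 5 phi.code
  | .sall phi => Nat.pair 6 phi.code

theorem SOForm.code_injective : Function.Injective SOForm.code := by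
  intro phi
  induction phi <;> intro psi h <;> cases psi <;>
    simp_all [SOForm.code, Nat.pair_eq_pair] <;> grind

instance : Countable SOForm := SOForm.code_injective.countable

theorem mk_rank_le_lt (hc : c.IsInaccessible) {alpha : Ordinal.{0}} (ha : alpha < c.ord) :
    #{x : ZFSet.{0} | x.rank ≤ alpha} < lift.{1} c := by
  have hset : {x : ZFSet.{0} | x.rank ≤ alpha} =
      {x | x ∈ ZFSet.vonNeumann (alpha + 1)} := by
    ext x; simp [ZFSet.subset_vonNeumann]
  rw [hset]
  change #(ZFSet.vonNeumann (alpha + 1)) < _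
  rw [ZFSet.cardinalMk_coe_sort, ZFSet.card_vonNeumann, Cardinal.lift_lt]
  calc preBeth (alpha + 1) < preBeth c.ord :=
        preBeth_lt_preBeth.2 ((isSuccLimit_ord hc.aleph0_lt.le).add_one_lt ha)
    _ = c := hc.preBeth_ord

/-- Sets are ranked as usual, ordinals by themselves, and formulas have rank `0`. -/
noncomputable def codeRank : (ZFSet.{0} ⊕ Ordinal.{0}) ⊕ SOForm → Ordinal.{0} :=
  Sum.elim (Sum.elim ZFSet.rank id) fun _ => 0

theorem mk_codeRank_le_lt (hc : c.IsInaccessible) {alpha : Ordinal.{0}} (ha : alpha < c.ord) :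
    #{x | codeRank x ≤ alpha} < lift.{1} c := by
  have hsub : {x | codeRank x ≤ alpha} ⊆
      Sum.inl '' (Sum.inl '' {x : ZFSet.{0} | x.rank ≤ alpha} ∪ Sum.inr '' Set.Iio (alpha + 1)) ∪
        Set.range Sum.inr := by
    rintro ((x | x) | x) hx <;> simp_all [codeRank]
  have hinf : ℵ₀ ≤ lift.{1} c := aleph0_le_lift.2 hc.aleph0_lt.le
  refine (mk_le_mk_of_subset hsub).trans_lt ((mk_union_le _ _).trans_lt ?_)
  refine add_lt_of_lt hinf (mk_image_le.trans_lt ((mk_union_le _ _).trans_lt ?_)) ?_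
  · refine add_lt_of_lt hinf (mk_image_le.trans_lt (mk_rank_le_lt hc ha))
      (mk_image_le.trans_lt ?_)
    rw [Cardinal.mk_Iio_ordinal, Cardinal.lift_lt, ← lt_ord]
    exact (isSuccLimit_ord hc.aleph0_lt.le).add_one_lt ha
  · refine (Set.countable_range _).le_aleph0.trans_lt ?_
    rw [← lift_aleph0.{1, 0}, Cardinal.lift_lt]
    exact hc.aleph0_lt

end Coding

section Indescribable

theorem PiIndesc.nonempty {X : Set Ordinal.{0}} {alpha : Ordinal.{0}}
    (h : PiIndesc 0 X alpha) : X.Nonempty := by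
  obtain ⟨xi, hxi, -⟩ := h.2 ∅ (Set.empty_subset _) (.not (.inA 0)) (.fo trivial)
    (by simp [SOSatS, SOSat])
  exact ⟨xi, hxi⟩

theorem PiIndesc.exists_gt {X : Set Ordinal.{0}} {alpha beta : Ordinal.{0}}
    (h : PiIndesc 0 X alpha) (hb : beta < alpha) : ∃ xi ∈ X, beta < xi := by
  have hrank : ZFSet.rank beta.toZFSet = beta := Ordinal.rank_toZFSet beta
  obtain ⟨xi, hxi, hsat⟩ := h.2 {beta.toZFSet} (by simpa [Vrank, hrank] using hb)
    (.not (.fall (.not (.inA 0)))) (.fo trivial)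
    (by simpa [SOSatS, SOSat, consVal, Vrank, hrank] using hb)
  refine ⟨xi, hxi, ?_⟩
  simpa [SOSatS, SOSat, consVal, Vrank, hrank] using hsat

theorem homog_setOf_coherent (L : Ordinal.{0} → Set Ordinal.{0}) (Y : Set Ordinal.{0})
    (alpha : Ordinal.{0}) :
    Homog L {beta ∈ Y ∩ Set.Iio alpha | L beta = L alpha ∩ Set.Iio beta} := by
  intro beta hb gamma hg hlt
  rw [hb.2, hg.2, Set.inter_assoc, Set.inter_eq_right.2 (Set.Iio_subset_Iio hlt.le)]

end Indescribable

/-- Baumgartner. `S ⊆ κ` is subtle iff for every `S`-list `L` and every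
club `C ⊆ κ` there is `α ∈ S ∩ C` such that some `H ⊆ S ∩ C ∩ α` is homogeneous for `L`
and `Π¹ₙ`-indescribable in `α` for all `n < ω`. -/
theorem subtle_iff_indescribable_homogeneous (kappa : Ordinal.{0})
    (hreg : RegUncountable kappa) (S : Set Ordinal.{0}) (hS : S ⊆ Set.Iio kappa) :
    IsSubtleIn S kappa ↔
      ∀ L : Ordinal.{0} → Set Ordinal.{0}, (∀ alpha ∈ S, L alpha ⊆ Set.Iio alpha) →
        ∀ C, IsClubIn C kappa →
          ∃ alpha ∈ S ∩ C, ∃ H, H ⊆ S ∩ C ∩ Set.Iio alpha ∧ Homog L H ∧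
            ∀ n : ℕ, PiIndesc n H alpha := by
  constructor
  · intro h L hL C hC
    obtain ⟨c, hc, hc', rfl⟩ := hreg.exists_isRegular
    have hin := h.isInaccessible hc hc'
    by_contra! hno
    have hwit : ∀ alpha, ∃ (A : Set ZFSet.{0}) (phi : SOForm), alpha ∈ S ∩ C →
        A ⊆ Vrank alpha ∧ SOSatS (Vrank alpha) A phi ∧
        ∀ xi ∈ S ∩ C ∩ Set.Iio alpha, L xi = L alpha ∩ Set.Iio xi →
          ¬ SOSatS (Vrank xi) (A ∩ Vrank xi) phi := by
      intro alpha
      by_cases ha : alpha ∈ S ∩ C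
      · obtain ⟨n, hn⟩ := hno alpha ha _ (fun x hx => hx.1) (homog_setOf_coherent L (S ∩ C) alpha)
        rw [PiIndesc] at hn
        push Not at hn
        obtain ⟨A, hA, phi, -, hsat, hxi⟩ := hn fun x hx => hx.1.2
        exact ⟨A, phi, fun _ => ⟨hA, hsat, fun xi h1 h2 => hxi xi ⟨h1, h2⟩⟩⟩
      · exact ⟨∅, .inA 0, fun h => absurd h ha⟩
    choose A phi hwit using hwit
    obtain ⟨alpha, ha, beta, hb, hab, hcoh⟩ := h.exists_coherent hc hc' codeRank
      (fun _ => mk_codeRank_le_lt hin)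
      (fun alpha => Sum.inl '' (Sum.inl '' A alpha ∪ Sum.inr '' L alpha) ∪ {Sum.inr (phi alpha)})
      hC.pos_mem
    have h0 : 0 < alpha := ha.2.2
    replace ha : alpha ∈ S ∩ C := ⟨ha.1, ha.2.1⟩
    replace hb : beta ∈ S ∩ C := ⟨hb.1, hb.2.1⟩
    have hphi : phi alpha = phi beta := by
      simpa [codeRank, h0] using hcoh (.inr (phi alpha))
    have hLc : L alpha = L beta ∩ Set.Iio alpha := by
      ext x
      have := hcoh (.inl (.inr x))
      have hx := @hL alpha ha.1 x
      simp only [codeRank, Sum.elim_inl, Sum.elim_inr, id] at this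
      simp at this hx ⊢
      tauto
    have hAc : A alpha = A beta ∩ Vrank alpha := by
      ext x
      have := hcoh (.inl (.inl x))
      have hx := @(hwit alpha ha).1 x
      simp [codeRank, Vrank] at this hx ⊢
      tauto
    refine (hwit beta hb).2.2 alpha ⟨ha, hab⟩ hLc ?_
    rw [← hAc, ← hphi]
    exact (hwit alpha ha).2.1
  · refine fun h => ⟨hS, fun L hL C hC => ?_⟩
    obtain ⟨alpha, -, H, hH, hhom, hind⟩ := h L hL C hC
    obtain ⟨beta, hb⟩ := (hind 0).nonempty
    obtain ⟨gamma, hg, hlt⟩ := (hind 0).exists_gt (hH hb).2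
    exact ⟨beta, (hH hb).1, gamma, (hH hg).1, hlt, hhom beta hb gamma hg hlt⟩

end LCI
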